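/- For every smooth function H on ℝ^(2n+2): (i) the cocontact gradient vector field grad X^{cc}_H satisfies div(grad X^{cc}_H) = ∂²H/∂t² − (n+1) ∂H/∂z and (grad X^{cc}_H)(H) = (∂H/∂t)² − H ∂H/∂z; (ii) the energy gradient vector field grad ℰ^{cc}_H satisfies div(grad ℰ^{cc}_H) = ∂²H/∂t² − n ∂H/∂z and (grad ℰ^{cc}_H)(H) = (∂H/∂t)²; (iii) if moreover ∂H/∂z = 0, the strict gradient vector field grad ξ^{cc}_H satisfies div(grad ξ^{cc}_H) = ∂²H/∂t². -/

import Mathlib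

noncomputable section

/-- The cocontact phase space `ℝ^(2n+2)` with coordinates `(t, q, p, z)`. -/
abbrev Cn (n : ℕ) : Type := ℝ × (Fin n → ℝ) × (Fin n → ℝ) × ℝ

/-- Coordinate direction `∂/∂t` (the Reeb field `R^τ`). -/
def eT (n : ℕ) : Cn n := (1, 0, 0, 0)

/-- Coordinate direction `∂/∂qⁱ`. -/
def eQ (n : ℕ) (i : Fin n) : Cn n := (0, Pi.single i 1, 0, 0)

/-- Coordinate direction `∂/∂pᵢ`. -/
def eP (n : ℕ) (i : Fin n) : Cn n := (0, 0, Pi.single i 1, 0)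

/-- Coordinate direction `∂/∂z` (the Reeb field `R^η`). -/
def eZ (n : ℕ) : Cn n := (0, 0, 0, 1)

/-- Partial derivative of `F` in the direction `v`. -/
def pd {n : ℕ} (F : Cn n → ℝ) (v : Cn n) (x : Cn n) : ℝ := fderiv ℝ F x v

/-- The cocontact gradient vector field `grad X^{cc}_H`: `t`-component `∂H/∂t`,
`qⁱ`-component `∂H/∂pᵢ`, `pᵢ`-component `−(∂H/∂qⁱ + pᵢ ∂H/∂z)`,
`z`-component `Σᵢ pᵢ ∂H/∂pᵢ − H`. -/
def gradXcc {n : ℕ} (H : Cn n → ℝ) : Cn n → Cn n :=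
  fun x => (pd H (eT n) x,
            fun i => pd H (eP n i) x,
            fun i => - (pd H (eQ n i) x + x.2.2.1 i * pd H (eZ n) x),
            (∑ i, x.2.2.1 i * pd H (eP n i) x) - H x)

/-- The energy gradient vector field `grad ℰ^{cc}_H`: same components but
`z`-component `Σᵢ pᵢ ∂H/∂pᵢ`. -/
def gradEcc {n : ℕ} (H : Cn n → ℝ) : Cn n → Cn n :=
  fun x => (pd H (eT n) x,
            fun i => pd H (eP n i) x,
            fun i => - (pd H (eQ n i) x + x.2.2.1 i * pd H (eZ n) x),
            ∑ i, x.2.2.1 i * pd H (eP n i) x)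

/-- The strict gradient vector field `grad ξ^{cc}_H` (for `z`-independent `H`):
`t`-component `∂H/∂t`, `qⁱ`-component `∂H/∂pᵢ`, `pᵢ`-component `−∂H/∂qⁱ`,
`z`-component `Σᵢ pᵢ ∂H/∂pᵢ − H`. -/
def gradXicc {n : ℕ} (H : Cn n → ℝ) : Cn n → Cn n :=
  fun x => (pd H (eT n) x,
            fun i => pd H (eP n i) x,
            fun i => - pd H (eQ n i) x,
            (∑ i, x.2.2.1 i * pd H (eP n i) x) - H x)

/-- Coordinate divergence of a vector field on `ℝ^(2n+2)`. -/
def divcc {n : ℕ} (X : Cn n → Cn n) : Cn n → ℝ :=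
  fun x => fderiv ℝ (fun y => (X y).1) x (eT n)
    + (∑ i, fderiv ℝ (fun y => (X y).2.1 i) x (eQ n i))
    + (∑ i, fderiv ℝ (fun y => (X y).2.2.1 i) x (eP n i))
    + fderiv ℝ (fun y => (X y).2.2.2) x (eZ n)

/-- Partial derivatives of a smooth function are differentiable. -/
lemma pd_differentiable {n : ℕ} {H : Cn n → ℝ} (hH : ContDiff ℝ (⊤ : ℕ∞) H) (v : Cn n) :
    Differentiable ℝ (pd H v) := by
  have h1 : ContDiff ℝ 1 (fderiv ℝ H) := hH.fderiv_right (by norm_cast)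
  have h2 : Differentiable ℝ (fderiv ℝ H) := h1.differentiable (by norm_num)
  intro x
  exact (h2 x).clm_apply (differentiableAt_const v)

/-- Symmetry of second partial derivatives. -/
lemma pd_symm {n : ℕ} {H : Cn n → ℝ} (hH : ContDiff ℝ (⊤ : ℕ∞) H) (v w x : Cn n) :
    fderiv ℝ (pd H v) x w = fderiv ℝ (pd H w) x v := by
  have h1 : ContDiff ℝ 1 (fderiv ℝ H) := hH.fderiv_right (by norm_cast)
  have h2 : Differentiable ℝ (fderiv ℝ H) := h1.differentiable (by norm_num)
  have key : ∀ u w : Cn n, fderiv ℝ (pd H u) x w = fderiv ℝ (fderiv ℝ H) x w u := by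
    intro u w
    have h := ((h2 x).hasFDerivAt.clm_apply (hasFDerivAt_const u x)).fderiv
    have h' : fderiv ℝ (pd H u) x = _ := h
    rw [h']
    simp
  rw [key, key]
  have hs : IsSymmSndFDerivAt ℝ H x := by
    have hc : ContDiffAt ℝ 2 H x := hH.contDiffAt.of_le (by norm_cast)
    exact hc.isSymmSndFDerivAt (by simp)
  exact hs.eq w v

/-- The momentum coordinate as a continuous linear map. -/
def pcoord (n : ℕ) (i : Fin n) : Cn n →L[ℝ] ℝ :=
  (ContinuousLinearMap.proj (R := ℝ) (φ := fun _ : Fin n => ℝ) i).comp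
    ((ContinuousLinearMap.fst ℝ (Fin n → ℝ) ℝ).comp
      ((ContinuousLinearMap.snd ℝ (Fin n → ℝ) ((Fin n → ℝ) × ℝ)).comp
        (ContinuousLinearMap.snd ℝ ℝ ((Fin n → ℝ) × (Fin n → ℝ) × ℝ))))

lemma pcoord_apply (n : ℕ) (i : Fin n) (x : Cn n) : pcoord n i x = x.2.2.1 i := rfl

/-- Product rule for a momentum coordinate times a function. -/
lemma hasFDerivAt_p_mul {n : ℕ} {F : Cn n → ℝ} (hF : Differentiable ℝ F) (i : Fin n) (x : Cn n) :
    HasFDerivAt (fun y : Cn n => y.2.2.1 i * F y)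
      (x.2.2.1 i • fderiv ℝ F x + F x • pcoord n i) x :=
  (pcoord n i).hasFDerivAt.mul (hF x).hasFDerivAt

/-- Derivative of the momentum component. -/
lemma fderiv_pcomp {n : ℕ} {H : Cn n → ℝ} (hH : ContDiff ℝ (⊤ : ℕ∞) H) (i : Fin n) (x : Cn n) :
    fderiv ℝ (fun y : Cn n => - (pd H (eQ n i) y + y.2.2.1 i * pd H (eZ n) y)) x (eP n i)
      = - (fderiv ℝ (pd H (eQ n i)) x (eP n i)
          + (x.2.2.1 i * fderiv ℝ (pd H (eZ n)) x (eP n i) + pd H (eZ n) x)) := by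
  have h := (((pd_differentiable hH (eQ n i)) x).hasFDerivAt.add
    (hasFDerivAt_p_mul (pd_differentiable hH (eZ n)) i x)).neg
  have h' := h.fderiv
  have h'' : fderiv ℝ (fun y : Cn n => - (pd H (eQ n i) y + y.2.2.1 i * pd H (eZ n) y)) x = _ := h'
  rw [h'']
  simp [pcoord_apply, eP]

lemma hasFDerivAt_sum_p {n : ℕ} {H : Cn n → ℝ} (hH : ContDiff ℝ (⊤ : ℕ∞) H) (x : Cn n) :
    HasFDerivAt (fun y : Cn n => ∑ i, y.2.2.1 i * pd H (eP n i) y)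
      (∑ i, (x.2.2.1 i • fderiv ℝ (pd H (eP n i)) x + pd H (eP n i) x • pcoord n i)) x :=
  HasFDerivAt.fun_sum fun i _ => hasFDerivAt_p_mul (pd_differentiable hH (eP n i)) i x

/-- Derivative of the `z`-component of the energy field. -/
lemma fderiv_zcomp {n : ℕ} {H : Cn n → ℝ} (hH : ContDiff ℝ (⊤ : ℕ∞) H) (x : Cn n) :
    fderiv ℝ (fun y : Cn n => ∑ i, y.2.2.1 i * pd H (eP n i) y) x (eZ n)
      = ∑ i, x.2.2.1 i * fderiv ℝ (pd H (eP n i)) x (eZ n) := by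
  rw [(hasFDerivAt_sum_p hH x).fderiv]
  simp [pcoord_apply, eZ]

/-- Derivative of the `z`-component of the gradient field. -/
lemma fderiv_zcomp_sub {n : ℕ} {H : Cn n → ℝ} (hH : ContDiff ℝ (⊤ : ℕ∞) H) (x : Cn n) :
    fderiv ℝ (fun y : Cn n => (∑ i, y.2.2.1 i * pd H (eP n i) y) - H y) x (eZ n)
      = (∑ i, x.2.2.1 i * fderiv ℝ (pd H (eP n i)) x (eZ n)) - pd H (eZ n) x := by
  have hd : DifferentiableAt ℝ H x := hH.differentiable (by norm_num) x
  rw [← fderiv_zcomp hH, fderiv_fun_sub (hasFDerivAt_sum_p hH x).differentiableAt hd]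
  rfl

lemma divE {n : ℕ} {H : Cn n → ℝ} (hH : ContDiff ℝ (⊤ : ℕ∞) H) (x : Cn n) :
    divcc (gradEcc H) x = pd (pd H (eT n)) (eT n) x - (n : ℝ) * pd H (eZ n) x := by
  simp only [divcc, gradEcc]
  rw [fderiv_zcomp hH, Finset.sum_congr rfl (fun i _ => fderiv_pcomp hH i x),
    Finset.sum_congr rfl (fun i _ => pd_symm hH (eP n i) (eQ n i) x),
    Finset.sum_congr rfl
      (fun i _ => congrArg (x.2.2.1 i * ·) (pd_symm hH (eP n i) (eZ n) x))]
  simp only [Finset.sum_neg_distrib, Finset.sum_add_distrib, Finset.sum_const, Finset.card_univ,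
    Fintype.card_fin, nsmul_eq_mul]
  change pd (pd H (eT n)) (eT n) x + _ + _ + _ = _
  ring

lemma divX {n : ℕ} {H : Cn n → ℝ} (hH : ContDiff ℝ (⊤ : ℕ∞) H) (x : Cn n) :
    divcc (gradXcc H) x = divcc (gradEcc H) x - pd H (eZ n) x := by
  simp only [divcc, gradEcc, gradXcc]
  rw [fderiv_zcomp hH, fderiv_zcomp_sub hH]
  ring

/-- Coordinate expansion of a vector. -/
lemma vec_expand {n : ℕ} (v : Cn n) :
    v = v.1 • eT n + ∑ i, v.2.1 i • eQ n i + ∑ i, v.2.2.1 i • eP n i + v.2.2.2 • eZ n := by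
  obtain ⟨t, q, p, z⟩ := v
  refine Prod.ext ?_ (Prod.ext ?_ (Prod.ext ?_ ?_))
  · simp [eT, eQ, eP, eZ, Prod.fst_sum]
  · ext j
    simp [eT, eQ, eP, eZ, Prod.fst_sum, Prod.snd_sum, Finset.sum_apply, Pi.single_apply]
  · ext j
    simp [eT, eQ, eP, eZ, Prod.fst_sum, Prod.snd_sum, Finset.sum_apply, Pi.single_apply]
  · simp [eT, eQ, eP, eZ, Prod.snd_sum]

lemma fderiv_expand {n : ℕ} (H : Cn n → ℝ) (x v : Cn n) :
    fderiv ℝ H x v = v.1 * pd H (eT n) x + ∑ i, v.2.1 i * pd H (eQ n i) x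
      + ∑ i, v.2.2.1 i * pd H (eP n i) x + v.2.2.2 * pd H (eZ n) x := by
  conv_lhs => rw [vec_expand v]
  simp only [map_add, map_sum, map_smul, smul_eq_mul, pd]

lemma energyE {n : ℕ} (H : Cn n → ℝ) (x : Cn n) :
    fderiv ℝ H x (gradEcc H x) = (pd H (eT n) x) ^ 2 := by
  rw [fderiv_expand]
  simp only [gradEcc]
  rw [Finset.sum_mul, add_assoc, add_assoc, ← Finset.sum_add_distrib, ← Finset.sum_add_distrib,
    Finset.sum_eq_zero (fun i _ => by ring)]
  ring

lemma energyX {n : ℕ} (H : Cn n → ℝ) (x : Cn n) :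
    fderiv ℝ H x (gradXcc H x) = (pd H (eT n) x) ^ 2 - H x * pd H (eZ n) x := by
  rw [← energyE, fderiv_expand, fderiv_expand]
  simp only [gradEcc, gradXcc]
  ring

lemma pd_z_zero {n : ℕ} {H : Cn n → ℝ} (hH : ContDiff ℝ (⊤ : ℕ∞) H)
    (hz : ∀ (t : ℝ) (q p : Fin n → ℝ) (z z' : ℝ), H (t, q, p, z) = H (t, q, p, z')) :
    pd H (eZ n) = fun _ => 0 := by
  funext x
  have hd : DifferentiableAt ℝ H x := hH.differentiable (by norm_num) x
  rw [pd, ← hd.lineDeriv_eq_fderiv, lineDeriv]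
  have : (fun s : ℝ => H (x + s • eZ n)) = fun _ => H x := by
    funext s
    obtain ⟨t, q, p, z⟩ := x
    simpa [eZ] using hz t q p (z + s) z
  rw [this, deriv_const]

/-- Divergences and energy rates of the cocontact gradient, energy gradient and
strict gradient vector fields. -/
theorem cocontact_gradient_fields_divergence_energy (n : ℕ) (H : Cn n → ℝ)
    (hH : ContDiff ℝ (⊤ : ℕ∞) H) :
    ((∀ x, divcc (gradXcc H) x
        = pd (pd H (eT n)) (eT n) x - ((n : ℝ) + 1) * pd H (eZ n) x)
      ∧ (∀ x, fderiv ℝ H x (gradXcc H x)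
        = (pd H (eT n) x) ^ 2 - H x * pd H (eZ n) x))
  ∧ ((∀ x, divcc (gradEcc H) x
        = pd (pd H (eT n)) (eT n) x - (n : ℝ) * pd H (eZ n) x)
      ∧ (∀ x, fderiv ℝ H x (gradEcc H x) = (pd H (eT n) x) ^ 2))
  ∧ ((∀ (t : ℝ) (q p : Fin n → ℝ) (z z' : ℝ), H (t, q, p, z) = H (t, q, p, z')) →
      ∀ x, divcc (gradXicc H) x = pd (pd H (eT n)) (eT n) x) := by
  refine ⟨⟨fun x => ?_, energyX H⟩, ⟨divE hH, energyE H⟩, fun hz x => ?_⟩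
  · rw [divX hH, divE hH]
    ring
  · have h0 := pd_z_zero hH hz
    have hX : gradXicc H = gradXcc H := by
      funext y
      simp only [gradXicc, gradXcc, h0, mul_zero, add_zero]
    rw [hX, divX hH, divE hH, h0]
    ring
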